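/- Let Γ be a countable group acting continuously on a compact metrizable space X. If the action is almost finite in measure, then the action is essentially free. -/

import Mathlib

open scoped Pointwise
open MeasureTheory

namespace Paper

section Basic

variable (G : Type*) [Group G] (X : Type*) [TopologicalSpace X] [MulAction G X]

/-- The action is minimal: every orbit is dense. -/
def Minimal : Prop := ∀ x : X, Dense (MulAction.orbit G x)

/-- The action is topologically free: every nontrivial fixed-point set is nowhere dense. -/
def TopFree : Prop := ∀ g : G, g ≠ 1 → interior (closure {x : X | g • x = x}) = (∅ : Set X)

variable [MeasurableSpace X]

/-- `μ` is a `G`-invariant Borel probability measure. -/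
def InvProb (μ : Measure X) : Prop :=
  IsProbabilityMeasure μ ∧ ∀ g : G, Measure.map (fun x : X => g • x) μ = μ

/-- The action is essentially free. -/
def EssFree : Prop :=
  ∀ g : G, g ≠ 1 → ∀ μ : Measure X, InvProb G X μ → μ {x : X | g • x = x} = 0

/-- The small boundary property. -/
def SBP : Prop :=
  ∀ (x : X) (U : Set X), IsOpen U → x ∈ U →
    ∃ V : Set X, IsOpen V ∧ x ∈ V ∧ V ⊆ U ∧
      ∀ μ : Measure X, InvProb G X μ → μ (frontier V) = 0

end Basic

/-- `S` is a `(K, ε)`-Følner set: `|KS \ S| < ε |S|`. -/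
def IsFolner {G : Type*} [Group G] (K S : Finset G) (ε : ℝ) : Prop :=
  letI := Classical.decEq G
  (((K * S) \ S).card : ℝ) < ε * S.card

/-- Amenability in the Følner sense. -/
def FolnerAmenable (G : Type*) [Group G] : Prop :=
  ∀ (K : Finset G) (ε : ℝ), 0 < ε → ∃ S : Finset G, IsFolner K S ε

/-- A finite family of towers forming a castle: all levels are pairwise disjoint. -/
def IsCastle (G : Type*) [Group G] (X : Type*) [MulAction G X] {n : ℕ}
    (S : Fin n → Finset G) (B : Fin n → Set X) : Prop :=
  ∀ (i j : Fin n), ∀ s ∈ S i, ∀ t ∈ S j, (i, s) ≠ (j, t) → Disjoint (s • B i) (t • B j)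

/-- The union of all levels of a castle. -/
def CastleUnion (G : Type*) [Group G] (X : Type*) [MulAction G X] {n : ℕ}
    (S : Fin n → Finset G) (B : Fin n → Set X) : Set X :=
  ⋃ i, ⋃ s ∈ S i, s • B i

/-- `C ≺ O` : dynamical subordination of a (closed) set `C` to `O`. -/
def Subord (G : Type*) [Group G] (X : Type*) [TopologicalSpace X] [MulAction G X]
    (C O : Set X) : Prop :=
  ∃ (n : ℕ) (V : Fin n → Set X) (g : Fin n → G),
    (∀ k, IsOpen (V k)) ∧ (C ⊆ ⋃ k, V k) ∧ (∀ k, g k • V k ⊆ O) ∧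
      Pairwise fun k l => Disjoint (g k • V k) (g l • V l)

/-- `U ≺ O` for open `U`: every closed subset of `U` is subordinate to `O`. -/
def SubordOpen (G : Type*) [Group G] (X : Type*) [TopologicalSpace X] [MulAction G X]
    (U O : Set X) : Prop :=
  ∀ C : Set X, IsClosed C → C ⊆ U → Subord G X C O

/-- Dynamical comparison. -/
def DynComparison (G : Type*) [Group G] (X : Type*) [TopologicalSpace X] [MulAction G X]
    [MeasurableSpace X] : Prop :=
  ∀ U O : Set X, IsOpen U → IsOpen O → U.Nonempty → O.Nonempty →
    (∀ μ : Measure X, InvProb G X μ → μ U < μ O) → SubordOpen G X U O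

/-- Almost finiteness (Kerr). -/
def AlmostFinite (G X : Type*) [Group G] [MetricSpace X] [MulAction G X] : Prop :=
  ∀ (K : Finset G) (m : ℕ), 0 < m → ∀ ε : ℝ, 0 < ε →
    ∃ (n : ℕ) (S : Fin n → Finset G) (B : Fin n → Set X),
      IsCastle G X S B ∧ (∀ i, IsOpen (B i)) ∧ (∀ i, IsFolner K (S i) ε) ∧
      (∀ i, ∀ s ∈ S i, Metric.diam (s • B i) < ε) ∧
      ∃ S' : Fin n → Finset G,
        (∀ i, S' i ⊆ S i ∧ ((S' i).card : ℝ) < (S i).card / m) ∧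
        Subord G X (Set.univ \ CastleUnion G X S B) (CastleUnion G X S' B)

/-- Almost finiteness in measure (Kerr–Szabó). -/
def AlmostFiniteInMeasure (G X : Type*) [Group G] [MetricSpace X] [MulAction G X]
    [MeasurableSpace X] : Prop :=
  ∀ (K : Finset G) (ε : ℝ), 0 < ε →
    ∃ (n : ℕ) (S : Fin n → Finset G) (B : Fin n → Set X),
      IsCastle G X S B ∧ (∀ i, IsOpen (B i)) ∧ (∀ i, IsFolner K (S i) ε) ∧
      (∀ i, ∀ s ∈ S i, Metric.diam (s • B i) < ε) ∧
      (⨆ μ : {μ : Measure X // InvProb G X μ},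
        (μ : Measure X) (Set.univ \ CastleUnion G X S B)) < ENNReal.ofReal ε

/-- Every finitely generated subgroup is finite. -/
def LocallyFiniteGroup (G : Type*) [Group G] : Prop :=
  ∀ H : Subgroup G, H.FG → (H : Set G).Finite

/-- `G` is virtually `ℤ`. -/
def VirtuallyZ (G : Type*) [Group G] : Prop :=
  ∃ H : Subgroup G, H.FiniteIndex ∧ Nonempty (H ≃* Multiplicative ℤ)

end Paper

namespace Paper

theorem InvProb.measure_smul_set {G X : Type*} [Group G] [TopologicalSpace X]
    [MeasurableSpace X] [BorelSpace X] [MulAction G X] [ContinuousConstSMul G X]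
    {μ : Measure X} (hμ : InvProb G X μ) (g : G) {B : Set X} (hB : IsOpen B) :
    μ (g • B) = μ B := by
  conv_lhs => rw [← hμ.2 g]
  rw [Measure.map_apply (continuous_const_smul g).measurable (hB.smul g).measurableSet,
    Set.preimage_smul, inv_smul_smul]

/-- The levels of a Følner shape which `g` moves out of the shape form a small proportion. -/
theorem IsFolner.card_filter_smul_notMem_lt {G : Type*} [Group G] {g : G} {S : Finset G}
    {ε : ℝ} (h : IsFolner {g} S ε) [DecidablePred fun s => g * s ∉ S] :
    ((S.filter fun s => g * s ∉ S).card : ℝ) < ε * S.card := by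
  classical
  refine lt_of_le_of_lt (Nat.cast_le.mpr ?_) h
  refine Finset.card_le_card_of_injOn (g * ·) (fun s hs => ?_) (mul_right_injective g).injOn
  have hs := Finset.mem_filter.mp hs
  refine Finset.mem_sdiff.mpr ⟨?_, hs.2⟩
  exact Finset.mul_mem_mul (Finset.mem_singleton_self g) hs.1

/-- A fixed point of `g` in a castle lies in a level which `g` moves out of its tower. -/
theorem IsCastle.fixedPoints_subset {G X : Type*} [Group G] [MulAction G X] {n : ℕ}
    {S : Fin n → Finset G} {B : Fin n → Set X} (h : IsCastle G X S B) {g : G} (hg : g ≠ 1)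
    [∀ i, DecidablePred fun s => g * s ∉ S i] :
    {x : X | g • x = x} ∩ CastleUnion G X S B ⊆
      CastleUnion G X (fun i => (S i).filter fun s => g * s ∉ S i) B := by
  rintro x ⟨hx, hxU⟩
  simp only [CastleUnion, Set.mem_iUnion] at hxU ⊢
  obtain ⟨i, s, hs, hxs⟩ := hxU
  refine ⟨i, s, Finset.mem_filter.mpr ⟨hs, fun hgs => ?_⟩, hxs⟩
  have hdisj : Disjoint (s • B i) ((g * s) • B i) :=
    h i i s hs (g * s) hgs fun heq => hg (by simpa using (Prod.mk.inj heq).2)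
  refine Set.disjoint_left.mp hdisj hxs ?_
  rw [mul_smul, ← show g • x = x from hx]
  exact Set.smul_mem_smul_set hxs

theorem InvProb.measure_castleUnion_le {G X : Type*} [Group G] [TopologicalSpace X]
    [MeasurableSpace X] [BorelSpace X] [MulAction G X] [ContinuousConstSMul G X]
    {μ : Measure X} (hμ : InvProb G X μ) {n : ℕ} (S : Fin n → Finset G) {B : Fin n → Set X}
    (hB : ∀ i, IsOpen (B i)) :
    μ (CastleUnion G X S B) ≤ ∑ i, (S i).card * μ (B i) := by
  refine (measure_iUnion_fintype_le μ _).trans (Finset.sum_le_sum fun i _ => ?_)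
  refine (measure_biUnion_finset_le _ _).trans_eq ?_
  simp [hμ.measure_smul_set _ (hB i)]

theorem InvProb.measure_castleUnion {G X : Type*} [Group G] [TopologicalSpace X]
    [MeasurableSpace X] [BorelSpace X] [MulAction G X] [ContinuousConstSMul G X]
    {μ : Measure X} (hμ : InvProb G X μ) {n : ℕ} {S : Fin n → Finset G} {B : Fin n → Set X}
    (h : IsCastle G X S B) (hB : ∀ i, IsOpen (B i)) :
    μ (CastleUnion G X S B) = ∑ i, (S i).card * μ (B i) := by
  rw [CastleUnion, measure_iUnion, tsum_fintype]
  · refine Finset.sum_congr rfl fun i _ => ?_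
    rw [measure_biUnion_finset]
    · simp [hμ.measure_smul_set _ (hB i)]
    · intro s hs t ht hst
      exact h i i s hs t ht (by simpa using hst)
    · exact fun s _ => ((hB i).smul s).measurableSet
  · intro i j hij
    simp only [Function.onFun, Set.disjoint_iUnion_left, Set.disjoint_iUnion_right]
    intro s hs t ht
    exact h i j _ (by assumption) _ (by assumption) (by simp [hij])
  · exact fun i => Finset.measurableSet_biUnion _ fun s _ => ((hB i).smul s).measurableSet

end Paper

open Paper

theorem essFree_of_almostFiniteInMeasure
    (G : Type*) [Group G] [Countable G]
    (X : Type*) [MetricSpace X] [CompactSpace X]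
    [MeasurableSpace X] [BorelSpace X]
    [MulAction G X] [ContinuousConstSMul G X]
    (h : AlmostFiniteInMeasure G X) :
    EssFree G X := by
  classical
  intro g hg μ hμ
  have := hμ.1
  have hle : ∀ ε : ℝ, 0 < ε → μ {x : X | g • x = x} ≤ ENNReal.ofReal ε + ENNReal.ofReal ε := by
    intro ε hε
    obtain ⟨n, S, B, hC, hB, hF, -, hsup⟩ := h {g} ε hε
    have hcompl : μ (Set.univ \ CastleUnion G X S B) ≤ ENNReal.ofReal ε :=
      (le_iSup (fun ν : {ν : Measure X // InvProb G X ν} =>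
        (ν : Measure X) (Set.univ \ CastleUnion G X S B)) ⟨μ, hμ⟩).trans hsup.le
    have hcard (i : Fin n) : (((S i).filter fun s => g * s ∉ S i).card : ENNReal) ≤
        ENNReal.ofReal ε * (S i).card := by
      rw [← ENNReal.ofReal_natCast, ← ENNReal.ofReal_natCast (S i).card,
        ← ENNReal.ofReal_mul hε.le]
      exact ENNReal.ofReal_le_ofReal (hF i).card_filter_smul_notMem_lt.le
    have hfix : μ ({x : X | g • x = x} ∩ CastleUnion G X S B) ≤ ENNReal.ofReal ε :=
      calc
        _ ≤ ∑ i, (((S i).filter fun s => g * s ∉ S i).card : ENNReal) * μ (B i) :=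
          (measure_mono (hC.fixedPoints_subset hg)).trans (hμ.measure_castleUnion_le _ hB)
        _ ≤ ∑ i, ENNReal.ofReal ε * ((S i).card * μ (B i)) :=
          Finset.sum_le_sum fun i _ => by rw [← mul_assoc]; gcongr; exact hcard i
        _ = ENNReal.ofReal ε * μ (CastleUnion G X S B) := by
          rw [hμ.measure_castleUnion hC hB, Finset.mul_sum]
        _ ≤ ENNReal.ofReal ε := mul_le_of_le_one_right' prob_le_one
    calc
      _ ≤ μ (({x : X | g • x = x} ∩ CastleUnion G X S B) ∪
          (Set.univ \ CastleUnion G X S B)) := measure_mono fun x hx => by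
        by_cases hxU : x ∈ CastleUnion G X S B
        · exact Or.inl ⟨hx, hxU⟩
        · exact Or.inr ⟨trivial, hxU⟩
      _ ≤ _ := (measure_union_le _ _).trans (add_le_add hfix hcompl)
  refine le_antisymm (ENNReal.le_of_forall_pos_le_add fun ε hε _ => ?_) bot_le
  refine (hle (ε / 2) (by positivity)).trans ?_
  rw [← ENNReal.ofReal_add (by positivity) (by positivity), add_halves,
    ENNReal.ofReal_coe_nnreal, zero_add]
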